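/- Let F ∈ 𝒜 and 0 < δ ≤ 1. (i) If 0 < θ < 1/2 and 𝓗(f_δ)(θ) > 0, then δ·𝓗(f_δ)(θ) ≤ 𝓗(F)(θ/δ). (ii) If −1/2 < θ < 0 and 𝓗(f_δ)(θ) > 0, then necessarily −δ/2 < θ < 0 and δ·𝓗(f_δ)(θ) ≤ 𝓗(f_1)(θ/δ), where f_1 is the periodization of F. -/

import Mathlib

open MeasureTheory

/-- `e t = e^{2πit}`. -/
noncomputable def e (t : ℝ) : ℂ := Complex.exp (2 * Real.pi * Complex.I * t)

/-- Fourier transform `F̂(t) = ∫ F(x) e^{-2πitx} dx`. -/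
noncomputable def FT (F : ℝ → ℝ) (t : ℝ) : ℂ :=
  ∫ x : ℝ, (F x : ℂ) * Complex.exp (-(2 * Real.pi * Complex.I) * t * x)

/-- Hilbert transform on `ℝ` via the multiplier `-i sgn(t)` and Fourier inversion. -/
noncomputable def HilbR (F : ℝ → ℝ) (x : ℝ) : ℂ :=
  ∫ t : ℝ, -Complex.I * (Real.sign t : ℂ) * FT F t * Complex.exp (2 * Real.pi * Complex.I * t * x)

/-- Hilbert transform on `ℝ/ℤ` of the periodization of `F_δ`, via the multiplier `-i sgn(k)`. -/
noncomputable def HilbPer (F : ℝ → ℝ) (δ : ℝ) (θ : ℝ) : ℂ :=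
  ∑' k : ℤ, -Complex.I * (Int.sign k : ℂ) * FT F (δ * k) *
    Complex.exp (2 * Real.pi * Complex.I * k * θ)

/-- The class `𝒜`: even, continuous, nonnegative, supported in `[-1/2,1/2]`, with `F̂ ∈ L¹`. -/
def memA (F : ℝ → ℝ) : Prop :=
  Continuous F ∧ (∀ x, F (-x) = F x) ∧ (∀ x, 0 ≤ F x) ∧
    (∀ x : ℝ, x ∉ Set.Icc (-(1/2) : ℝ) (1/2) → F x = 0) ∧
    MeasureTheory.Integrable (FT F)

/-- `‖𝓗(F)‖_{L^∞(ℝ)}` (sup norm of a bounded continuous function). -/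
noncomputable def supHR (F : ℝ → ℝ) : ℝ := ⨆ x : ℝ, ‖HilbR F x‖

/-- `‖𝓗(f_δ)‖_{L^∞(ℝ/ℤ)}` (sup norm of a bounded continuous function). -/
noncomputable def supHPer (F : ℝ → ℝ) (δ : ℝ) : ℝ := ⨆ θ : ℝ, ‖HilbPer F δ θ‖

/-- `𝒞(F) = max{‖𝓗(F)‖_{L∞(ℝ)}, ‖𝓗(f_F)‖_{L∞(ℝ/ℤ)}}`. -/
noncomputable def CF (F : ℝ → ℝ) : ℝ := max (supHR F) (supHPer F 1)

/-- The odd kernel transform `S F x t = ∫ F(y) 2 sin(2πt(x-y)) dy`. -/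
noncomputable def SS (F : ℝ → ℝ) (x t : ℝ) : ℝ :=
  ∫ y : ℝ, F y * (2 * Real.sin (2 * Real.pi * t * (x - y)))

lemma memA_hcs {F : ℝ → ℝ} (hF : memA F) : HasCompactSupport F :=
  HasCompactSupport.intro (isCompact_Icc) hF.2.2.2.1

lemma memA_int {F : ℝ → ℝ} (hF : memA F) : Integrable F :=
  hF.1.integrable_of_hasCompactSupport (memA_hcs hF)

lemma int_mul {F g : ℝ → ℝ} (hF : memA F) (hg : Continuous g) : Integrable (fun y => F y * g y) :=
  (hF.1.mul hg).integrable_of_hasCompactSupport ((memA_hcs hF).mul_right)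

lemma int_mulC {F : ℝ → ℝ} {g : ℝ → ℂ} (hF : memA F) (hg : Continuous g) :
    Integrable (fun y => (F y : ℂ) * g y) := by
  refine ((Complex.continuous_ofReal.comp hF.1).mul hg).integrable_of_hasCompactSupport ?_
  exact HasCompactSupport.mul_right (f := fun y => (F y : ℂ))
    ((memA_hcs hF).comp_left (g := fun r : ℝ => (r : ℂ)) (by simp))

lemma core {F : ℝ → ℝ} (hF : memA F) (x t : ℝ) :
    -Complex.I * FT F t * Complex.exp (2 * Real.pi * Complex.I * t * x)
      + Complex.I * FT F (-t) * Complex.exp (2 * Real.pi * Complex.I * (-t) * x)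
      = (SS F x t : ℂ) := by
  unfold FT SS
  rw [← integral_complex_ofReal]
  rw [← integral_const_mul, ← integral_const_mul, ← integral_mul_const, ← integral_mul_const,
    ← integral_add]
  · refine integral_congr_ae (Filter.Eventually.of_forall fun y => ?_)
    simp only
    push_cast
    rw [Complex.sin]
    have e1 : Complex.exp (2 * Real.pi * t * (x - y) * Complex.I)
      = Complex.exp (-(2 * Real.pi * Complex.I) * t * y) *
        Complex.exp (2 * Real.pi * Complex.I * t * x) := by
      rw [← Complex.exp_add]; congr 1; ring
    have e2 : Complex.exp (-(2 * Real.pi * t * (x - y)) * Complex.I)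
      = Complex.exp (-(2 * Real.pi * Complex.I) * -t * y) *
        Complex.exp (2 * Real.pi * Complex.I * -t * x) := by
      rw [← Complex.exp_add]; congr 1; ring
    rw [e1, e2]
    ring
  · refine Integrable.mul_const (Integrable.const_mul ?_ _) _
    exact int_mulC hF (by fun_prop)
  · refine Integrable.mul_const (Integrable.const_mul ?_ _) _
    exact int_mulC hF (by fun_prop)

/-- The summand in `HilbPer`. -/
noncomputable def tm (F : ℝ → ℝ) (δ θ : ℝ) (k : ℤ) : ℂ :=
  -Complex.I * (Int.sign k : ℂ) * FT F (δ * k) *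
    Complex.exp (2 * Real.pi * Complex.I * k * θ)

lemma L1 {F : ℝ → ℝ} (hF : memA F) (δ x : ℝ) (hs : Summable (tm F δ (δ * x))) :
    HasSum (fun n : ℕ => SS F x (δ * n)) (HilbPer F δ (δ * x)).re := by
  have h := hs.hasSum.nat_add_neg
  have h0 : tm F δ (δ * x) 0 = 0 := by simp [tm]
  rw [h0, add_zero] at h
  have h2 := Complex.hasSum_re h
  refine h2.congr_fun ?_ |> fun h => h
  intro n
  rcases Nat.eq_zero_or_pos n with rfl | hn
  · simp [h0, SS]
  · have := core hF x (δ * n)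
    have e : tm F δ (δ * x) n + tm F δ (δ * x) (-n) = (SS F x (δ * n) : ℂ) := by
      rw [← this]
      have s1 : Int.sign (n : ℤ) = 1 := Int.sign_eq_one_of_pos (by exact_mod_cast hn)
      simp only [tm, Int.sign_neg, s1]
      push_cast
      simp only [mul_neg, mul_one, neg_mul, neg_neg]
      ring_nf
    rw [e]; simp

lemma HilbR_integrable {F : ℝ → ℝ} (hF : memA F) (x : ℝ) : Integrable (fun t : ℝ =>
    -Complex.I * (Real.sign t : ℂ) * FT F t * Complex.exp (2 * Real.pi * Complex.I * t * x)) := by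
  have h := hF.2.2.2.2
  have hm : Measurable (Real.sign) := by
    unfold Real.sign
    exact Measurable.ite measurableSet_Iio measurable_const
      (Measurable.ite measurableSet_Ioi measurable_const measurable_const)
  have : Integrable (fun t : ℝ => (-Complex.I * (Real.sign t : ℂ) *
    Complex.exp (2 * Real.pi * Complex.I * t * x)) * FT F t) := by
    refine h.bdd_mul (c := 1) ?_ ?_
    · refine Measurable.aestronglyMeasurable ?_
      refine Measurable.mul ?_ ?_
      · exact (Complex.measurable_ofReal.comp hm).const_mul _
      · exact Continuous.measurable (by fun_prop)
    · refine Filter.Eventually.of_forall fun t => ?_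
      have : ‖Complex.exp (2 * Real.pi * Complex.I * t * x)‖ = 1 := by
        rw [Complex.norm_exp]; simp
      rw [norm_mul, this, norm_mul]
      simp only [norm_neg, Complex.norm_I, Complex.norm_real, one_mul, mul_one]
      rcases Real.sign_apply_eq t with h | h | h <;> simp [h]
  refine this.congr (Filter.Eventually.of_forall fun t => ?_)
  simp only; ring

lemma L2 {F : ℝ → ℝ} (hF : memA F) (x : ℝ) :
    IntegrableOn (SS F x) (Set.Ioi 0) ∧ (HilbR F x).re = ∫ t in Set.Ioi 0, SS F x t := by
  have hi := HilbR_integrable hF x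
  set g := (fun t : ℝ =>
    -Complex.I * (Real.sign t : ℂ) * FT F t * Complex.exp (2 * Real.pi * Complex.I * t * x)) with hg
  have hi2 := hi.comp_neg
  have key : Set.EqOn (fun t => g t + g (-t)) (fun t => (SS F x t : ℂ)) (Set.Ioi 0) := by
    intro t ht
    have := core hF x t
    simp only [hg]
    rw [← this, Real.sign_of_pos ht, Real.sign_of_neg (by simpa using ht)]
    push_cast; ring
  have hC : IntegrableOn (fun t => (SS F x t : ℂ)) (Set.Ioi 0) :=
    ((hi.add hi2).integrableOn).congr_fun key measurableSet_Ioi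
  refine ⟨?_, ?_⟩
  · have := hC.re
    simp only [RCLike.re_to_complex, Complex.ofReal_re] at this
    exact this
  · have e1 : HilbR F x = ∫ t in Set.Ioi 0, (SS F x t : ℂ) := by
      rw [← setIntegral_congr_fun measurableSet_Ioi key,
        integral_add hi.integrableOn hi2.integrableOn]
      rw [integral_comp_neg_Ioi (0:ℝ) g, neg_zero, add_comm,
        intervalIntegral.integral_Iic_add_Ioi hi.integrableOn hi.integrableOn]
      rfl
    rw [e1, integral_complex_ofReal, Complex.ofReal_re]

lemma exp_re_aux (a ε u : ℝ) :
    (-2 * Complex.I * Complex.exp (2 * Real.pi * Complex.I * (u + ε * Complex.I) * a)).re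
      = Real.exp (-(2 * Real.pi * ε * a)) * (2 * Real.sin (2 * Real.pi * a * u)) := by
  have : (2 * Real.pi * Complex.I * (u + ε * Complex.I) * a : ℂ)
      = ((-(2 * Real.pi * ε * a) : ℝ) : ℂ) + ((2 * Real.pi * a * u : ℝ) : ℂ) * Complex.I := by
    push_cast
    linear_combination (2 * Real.pi * ε * a : ℂ) * Complex.I_mul_I
  rw [this]
  generalize -(2 * Real.pi * ε * a) = p
  generalize 2 * Real.pi * a * u = q
  rw [Complex.exp_add, ← Complex.ofReal_exp, Complex.exp_mul_I, ← Complex.ofReal_cos,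
    ← Complex.ofReal_sin]
  generalize Real.exp p = P
  generalize Real.sin q = S
  generalize Real.cos q = C
  simp [Complex.mul_re, Complex.mul_im]
  ring

lemma cot_hasSum {δ ε : ℝ} (hδ : 0 < δ) (hε : 0 < ε) (u : ℝ) :
    HasSum (fun n : ℕ => (2 * Real.sin (2 * Real.pi * (δ * n) * u)) *
      Real.exp (-(2 * Real.pi * δ * ε)) ^ n)
      (Complex.cot (Real.pi * δ * (u + ε * Complex.I))).re := by
  have hw : 0 < ((δ : ℂ) * (u + ε * Complex.I)).im := by
    simp; positivity
  let w : UpperHalfPlane := ⟨(δ : ℂ) * (u + ε * Complex.I), hw⟩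
  have hc := pi_mul_cot_pi_q_exp w
  have hq : ‖Complex.exp (2 * Real.pi * Complex.I * w)‖ < 1 :=
    UpperHalfPlane.norm_exp_two_pi_I_lt_one w
  have hs := ((hasSum_geometric_of_norm_lt_one hq).mul_left (-2 * Complex.I))
  rw [← tsum_geometric_of_norm_lt_one hq] at hs
  have hcot : Complex.cot (Real.pi * δ * (u + ε * Complex.I)) = Complex.I +
      (-2 * Complex.I) * ∑' n : ℕ, Complex.exp (2 * Real.pi * Complex.I * w) ^ n := by
    have hp : (Real.pi : ℂ) ≠ 0 := by exact_mod_cast Real.pi_ne_zero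
    have hw' : (Real.pi * δ * (u + ε * Complex.I) : ℂ) = Real.pi * (w : ℂ) := by
      change _ = (Real.pi : ℂ) * ((δ : ℂ) * (u + ε * Complex.I)); ring
    rw [hw']
    apply mul_left_cancel₀ hp
    rw [hc]; ring
  have h2 := Complex.hasSum_re hs
  rw [hcot, Complex.add_re, Complex.I_re, zero_add]
  refine h2.congr_fun fun n => ?_
  rw [← Complex.exp_nat_mul]
  have := exp_re_aux (δ * n) ε u
  have e1 : (n * (2 * Real.pi * Complex.I * (w : ℂ)) : ℂ) =
      2 * Real.pi * Complex.I * (u + ε * Complex.I) * ((δ * n : ℝ) : ℂ) := by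
    change (n * (2 * Real.pi * Complex.I * ((δ : ℂ) * (u + ε * Complex.I))) : ℂ) = _
    push_cast; ring
  rw [e1, this, ← Real.exp_nat_mul, mul_comm]
  congr 2; ring

lemma L3 {F : ℝ → ℝ} (hF : memA F) {δ ε : ℝ} (hδ : 0 < δ) (hε : 0 < ε) (x : ℝ) :
    ∑' n : ℕ, SS F x (δ * n) * Real.exp (-(2 * Real.pi * δ * ε)) ^ n
      = ∫ y, F y * (Complex.cot (Real.pi * δ * ((x - y : ℝ) + ε * Complex.I))).re := by
  set r := Real.exp (-(2 * Real.pi * δ * ε)) with hr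
  have hr0 : 0 < r := Real.exp_pos _
  have hr1 : r < 1 := by
    rw [hr, Real.exp_lt_one_iff]; have := Real.pi_pos
    have : 0 < 2 * Real.pi * δ * ε := by positivity
    linarith
  have hint : ∀ n : ℕ, Integrable (fun y => F y *
      ((2 * Real.sin (2 * Real.pi * (δ * n) * (x - y))) * r ^ n)) := fun n =>
    int_mul hF (by fun_prop)
  have h := hasSum_integral_of_summable_integral_norm hint ?_
  · have e1 : ∀ n : ℕ, SS F x (δ * n) * r ^ n = ∫ y, F y *
      ((2 * Real.sin (2 * Real.pi * (δ * n) * (x - y))) * r ^ n) := by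
      intro n
      rw [SS, ← integral_mul_const]
      simp only [mul_assoc]
    simp only [e1]
    rw [h.tsum_eq]
    refine integral_congr_ae (Filter.Eventually.of_forall fun y => ?_)
    simp only
    rw [tsum_mul_left, (cot_hasSum hδ hε (x - y)).tsum_eq]
  · refine Summable.of_nonneg_of_le (fun n => by positivity) (fun n => ?_)
      ((summable_geometric_of_lt_one hr0.le hr1).mul_left (∫ y, ‖F y‖ * 2))
    rw [← integral_mul_const]
    refine integral_mono (hint n).norm (((memA_int hF).norm.mul_const _).mul_const _) fun y => ?_
    simp only [norm_mul, mul_assoc]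
    rw [Real.norm_of_nonneg (by norm_num : (0:ℝ) ≤ 2), Real.norm_of_nonneg (by positivity : 0 ≤ r^n)]
    have h1 := Real.abs_sin_le_one (2 * (Real.pi * (δ * (n * (x - y)))))
    rw [Real.norm_eq_abs (Real.sin _)]
    have h2 : 0 ≤ r ^ n := by positivity
    refine mul_le_mul_of_nonneg_left ?_ (norm_nonneg _)
    refine mul_le_mul_of_nonneg_left ?_ (by norm_num)
    exact mul_le_of_le_one_left h2 h1

lemma inner_int {ε : ℝ} (hε : 0 < ε) (u : ℝ) :
    ∫ t in Set.Ioi (0:ℝ), Real.exp (-(2 * Real.pi * ε * t)) * (2 * Real.sin (2 * Real.pi * t * u))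
      = ((Real.pi * (u + ε * Complex.I) : ℂ)⁻¹).re := by
  have hp := Real.pi_pos
  set a : ℂ := 2 * Real.pi * Complex.I * (u + ε * Complex.I) with ha
  have hare : a.re < 0 := by
    rw [ha]; simp [Complex.mul_re, Complex.mul_im]; positivity
  have hi := integrableOn_exp_mul_complex_Ioi hare 0
  have h := integral_exp_mul_complex_Ioi hare 0
  have e1 : ∀ t : ℝ, Real.exp (-(2 * Real.pi * ε * t)) * (2 * Real.sin (2 * Real.pi * t * u))
    = RCLike.re (-2 * Complex.I * Complex.exp (a * t)) := fun t => (exp_re_aux t ε u).symm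
  simp only [e1]
  rw [integral_re (hi.const_mul _), integral_const_mul, h, RCLike.re_to_complex]
  congr 1
  have hz : (u + ε * Complex.I : ℂ) ≠ 0 := by
    intro h0; have := congrArg Complex.im h0; simp at this; exact hε.ne' this
  have hp' : (Real.pi : ℂ) ≠ 0 := by exact_mod_cast hp.ne'
  have hI := Complex.I_ne_zero
  simp only [Complex.ofReal_zero, mul_zero, Complex.exp_zero, ha]
  field_simp

lemma L4 {F : ℝ → ℝ} (hF : memA F) {ε : ℝ} (hε : 0 < ε) (x : ℝ) :
    ∫ t in Set.Ioi (0:ℝ), Real.exp (-(2 * Real.pi * ε * t)) * SS F x t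
      = ∫ y, F y * ((Real.pi * ((x - y : ℝ) + ε * Complex.I) : ℂ)⁻¹).re := by
  have hp := Real.pi_pos
  have e1 : ∀ t, Real.exp (-(2 * Real.pi * ε * t)) * SS F x t = ∫ y, F y *
    (Real.exp (-(2 * Real.pi * ε * t)) * (2 * Real.sin (2 * Real.pi * t * (x - y)))) := by
    intro t
    rw [SS, ← integral_const_mul]
    congr 1; ext y; ring
  simp only [e1]
  rw [integral_integral_swap]
  · congr 1; ext y
    rw [integral_const_mul, inner_int hε]
  · have hexp : IntegrableOn (fun t => Real.exp (-(2 * Real.pi * ε * t))) (Set.Ioi 0) := by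
      have := integrableOn_exp_mul_Ioi (a := -(2 * Real.pi * ε)) (by
        have : 0 < 2 * Real.pi * ε := by positivity
        linarith) 0
      simpa using this
    have hb := (hexp.mul_const 2).mul_prod (memA_int hF)
    refine hb.mono' ?_ ?_
    · refine Continuous.aestronglyMeasurable ?_
      have := hF.1
      simp only [Function.uncurry_def]
      fun_prop
    · refine Filter.Eventually.of_forall fun p => ?_
      simp only [Function.uncurry_def, norm_mul, Real.norm_eq_abs, Real.abs_exp]
      rw [abs_of_nonneg (hF.2.2.1 _), abs_of_nonneg (by norm_num : (0:ℝ) ≤ 2)]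
      have := Real.abs_sin_le_one (2 * Real.pi * p.1 * (x - p.2))
      have h1 := hF.2.2.1 p.2
      have h2 := (Real.exp_pos (-(2 * Real.pi * ε * p.1))).le
      have := mul_le_mul_of_nonneg_left this (mul_nonneg h1 h2)
      linarith

lemma L5per {F : ℝ → ℝ} (hF : memA F) {δ : ℝ} (hδ : 0 < δ) (x : ℝ)
    (hs : Summable (tm F δ (δ * x))) :
    Filter.Tendsto (fun ε : ℝ => ∫ y, F y *
      (Complex.cot (Real.pi * δ * ((x - y : ℝ) + ε * Complex.I))).re)
      (nhdsWithin 0 (Set.Ioi 0)) (nhds (HilbPer F δ (δ * x)).re) := by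
  have hp := Real.pi_pos
  have h := Real.tendsto_tsum_powerSeries_nhdsWithin_lt (L1 hF δ x hs).tendsto_sum_nat
  have h2 : Filter.Tendsto (fun ε : ℝ => Real.exp (-(2 * Real.pi * δ * ε)))
      (nhdsWithin 0 (Set.Ioi 0)) (nhdsWithin 1 (Set.Iio 1)) := by
    refine tendsto_nhdsWithin_of_tendsto_nhds_of_eventually_within _ ?_ ?_
    · have : Continuous (fun ε : ℝ => Real.exp (-(2 * Real.pi * δ * ε))) := by fun_prop
      have := this.tendsto 0
      simp only [mul_zero, neg_zero, Real.exp_zero] at this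
      exact this.mono_left nhdsWithin_le_nhds
    · filter_upwards [self_mem_nhdsWithin] with ε hε
      have hε : 0 < ε := hε
      rw [Set.mem_Iio, Real.exp_lt_one_iff]
      have : 0 < 2 * Real.pi * δ * ε := by positivity
      linarith
  refine (h.comp h2).congr' ?_
  filter_upwards [self_mem_nhdsWithin] with ε hε
  exact L3 hF hδ hε x

lemma L5R {F : ℝ → ℝ} (hF : memA F) (x : ℝ) :
    Filter.Tendsto (fun ε : ℝ => ∫ y, F y *
      ((Real.pi * ((x - y : ℝ) + ε * Complex.I) : ℂ)⁻¹).re)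
      (nhdsWithin 0 (Set.Ioi 0)) (nhds (HilbR F x).re) := by
  have hp := Real.pi_pos
  obtain ⟨hi, he⟩ := L2 hF x
  rw [he]
  have : Filter.Tendsto (fun ε : ℝ => ∫ t in Set.Ioi (0:ℝ),
      Real.exp (-(2 * Real.pi * ε * t)) * SS F x t)
      (nhdsWithin 0 (Set.Ioi 0)) (nhds (∫ t in Set.Ioi (0:ℝ), SS F x t)) := by
    refine tendsto_integral_filter_of_dominated_convergence (fun t => ‖SS F x t‖) ?_ ?_ hi.norm ?_
    · refine Filter.Eventually.of_forall fun ε => ?_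
      exact (Continuous.aestronglyMeasurable (by fun_prop)).mul hi.1
    · filter_upwards [self_mem_nhdsWithin] with ε hε
      refine (ae_restrict_iff' measurableSet_Ioi).2 (Filter.Eventually.of_forall fun t ht => ?_)
      have hε : 0 < ε := hε
      have ht : 0 < t := ht
      rw [norm_mul, Real.norm_eq_abs, Real.abs_exp]
      refine mul_le_of_le_one_left (norm_nonneg _) ?_
      rw [Real.exp_le_one_iff]
      have : 0 < 2 * Real.pi * ε * t := by positivity
      linarith
    · refine Filter.Eventually.of_forall fun t => ?_
      have : Continuous (fun ε : ℝ => Real.exp (-(2 * Real.pi * ε * t)) * SS F x t) := by fun_prop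
      have := this.tendsto 0
      simp only [mul_zero, zero_mul, neg_zero, Real.exp_zero, one_mul] at this
      exact this.mono_left nhdsWithin_le_nhds
  refine this.congr' ?_
  filter_upwards [self_mem_nhdsWithin] with ε hε
  exact L4 hF hε x

lemma sin_ne_zero_of_re {w : ℂ} (h0 : w ≠ 0) (hw : |w.re| < Real.pi) : Complex.sin w ≠ 0 := by
  intro h
  obtain ⟨k, hk⟩ := Complex.sin_eq_zero_iff.1 h
  have hre : w.re = k * Real.pi := by rw [hk]; simp
  rw [hre, abs_mul, abs_of_pos Real.pi_pos] at hw
  have h1 : |(k : ℝ)| < 1 := by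
    by_contra hc
    push Not at hc
    nlinarith [Real.pi_pos]
  have h2 : |k| < 1 := by exact_mod_cast h1
  have : k = 0 := Int.abs_lt_one_iff.1 h2
  apply h0; rw [hk, this]; simp

lemma G_cont {w : ℂ} (hw : |w.re| < Real.pi) :
    ContinuousAt (fun w : ℂ => w⁻¹ - Complex.cot w) w := by
  by_cases h0 : w = 0
  · subst h0
    let s : ℂ → ℂ := dslope Complex.sin 0
    have hs : Differentiable ℂ s := by
      rw [← differentiableOn_univ]
      exact (Complex.differentiableOn_dslope Filter.univ_mem).2
        Complex.differentiable_sin.differentiableOn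
    let h : ℂ → ℂ := fun w => s w - Complex.cos w
    have hh : Differentiable ℂ h := hs.sub Complex.differentiable_cos
    let t : ℂ → ℂ := dslope h 0
    have ht : Differentiable ℂ t := by
      rw [← differentiableOn_univ]
      exact (Complex.differentiableOn_dslope Filter.univ_mem).2 hh.differentiableOn
    have s0 : s 0 = 1 := by simp [s, dslope_same]
    have hsw : ∀ w, Complex.sin w = w * s w := by
      intro w
      have := sub_smul_dslope Complex.sin 0 w
      simpa using this.symm
    have hh0 : h 0 = 0 := by simp [h, s0]
    have htw : ∀ w, h w = w * t w := by
      intro w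
      have := sub_smul_dslope h 0 w
      simpa [hh0] using this.symm
    have sev : ∀ w, s (-w) = s w := by
      intro w
      by_cases hw : w = 0
      · simp [hw]
      · have h1 := hsw w
        have h2 := hsw (-w)
        rw [Complex.sin_neg, h1] at h2
        have : w * (s (-w) - s w) = 0 := by linear_combination h2
        rcases mul_eq_zero.1 this with h | h
        · exact absurd h hw
        · exact sub_eq_zero.1 h
    have hev : (fun w => h (-w)) = h := by
      ext w; simp [h, sev]
    have t0 : t 0 = 0 := by
      have h1 : deriv (fun w => h (-w)) 0 = - deriv h (-0) := deriv_comp_neg h 0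
      rw [hev, neg_zero] at h1
      simp only [t, dslope_same]
      have : (2:ℂ) * deriv h 0 = 0 := by linear_combination h1
      simpa using this
    have hc : ContinuousAt (fun w => t w / s w) 0 :=
      ht.continuous.continuousAt.div hs.continuous.continuousAt (by simp [s0])
    refine hc.congr ?_
    have hn : ∀ᶠ w in nhds (0:ℂ), s w ≠ 0 :=
      hs.continuous.continuousAt.eventually_ne (by simp [s0])
    filter_upwards [hn] with w hw
    by_cases h1 : w = 0
    · subst h1; simp [t0, Complex.cot]
    · have e2 : s w = Complex.cos w + w * t w := by rw [← htw w]; simp [h]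
      rw [Complex.cot, hsw w]
      field_simp
      rw [e2]; ring
  · refine (continuousAt_inv₀ h0).sub ?_
    have : Complex.cot = fun w => Complex.cos w / Complex.sin w := by ext w; rfl
    rw [this]
    exact Complex.continuous_cos.continuousAt.div Complex.continuous_sin.continuousAt
      (sin_ne_zero_of_re h0 hw)

/-- The real kernel `1/v - cot v`. -/
noncomputable def KK (v : ℝ) : ℝ := v⁻¹ - Real.cot v

lemma KK_re (v : ℝ) : ((v : ℂ)⁻¹ - Complex.cot v).re = KK v := by
  rw [← Complex.ofReal_cot, ← Complex.ofReal_inv, ← Complex.ofReal_sub, Complex.ofReal_re, KK]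

lemma KK_zero : KK 0 = 0 := by simp [KK, Real.cot_eq_cos_div_sin]

lemma KK_odd (v : ℝ) : KK (-v) = - KK v := by
  simp [KK, Real.cot_eq_cos_div_sin, inv_neg, div_neg]; ring

lemma KK_cont {v : ℝ} (hv : |v| < Real.pi) : ContinuousAt KK v := by
  have h : ContinuousAt (fun v : ℝ => ((v : ℂ)⁻¹ - Complex.cot v).re) v := by
    refine Complex.continuous_re.continuousAt.comp ?_
    exact ContinuousAt.comp (f := fun v : ℝ => (v : ℂ)) (g := fun w : ℂ => w⁻¹ - Complex.cot w)
      (G_cont (by simpa using hv)) Complex.continuous_ofReal.continuousAt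
  simpa only [KK_re] using h

lemma KK_deriv {v : ℝ} (h0 : 0 < v) (h1 : v < Real.pi) :
    HasDerivAt KK (-(v ^ 2)⁻¹ + (Real.sin v ^ 2)⁻¹) v := by
  have hs := (Real.sin_pos_of_pos_of_lt_pi h0 h1).ne'
  have h := (hasDerivAt_inv h0.ne').sub
    ((Real.hasDerivAt_cos v).div (Real.hasDerivAt_sin v) hs)
  have e : KK = (fun v : ℝ => v⁻¹) - (Real.cos / Real.sin) := by
    ext v; simp [KK, Real.cot_eq_cos_div_sin]
  rw [e]
  refine h.congr_deriv ?_
  have := Real.sin_sq_add_cos_sq v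
  field_simp
  linear_combination (v^2) * this

lemma KK_mono : MonotoneOn KK (Set.Ico 0 Real.pi) := by
  refine monotoneOn_of_deriv_nonneg (convex_Ico _ _) ?_ ?_ ?_
  · intro v hv
    exact (KK_cont (by rw [abs_of_nonneg hv.1]; exact hv.2)).continuousWithinAt
  · rw [interior_Ico]; intro v hv
    exact (KK_deriv hv.1 hv.2).differentiableAt.differentiableWithinAt
  · rw [interior_Ico]; intro v hv
    rw [(KK_deriv hv.1 hv.2).deriv]
    have hs := Real.sin_pos_of_pos_of_lt_pi hv.1 hv.2
    have hl := Real.sin_lt hv.1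
    have : (v ^ 2)⁻¹ ≤ (Real.sin v ^ 2)⁻¹ := by gcongr
    linarith

lemma EE_mono {δ : ℝ} (hδ0 : 0 < δ) (hδ1 : δ ≤ 1) :
    MonotoneOn (fun v => KK v - δ * KK (δ * v)) (Set.Ico 0 Real.pi) := by
  have hd : ∀ v ∈ Set.Ioo 0 Real.pi, HasDerivAt (fun v => KK v - δ * KK (δ * v))
      ((Real.sin v ^ 2)⁻¹ - δ ^ 2 * (Real.sin (δ * v) ^ 2)⁻¹) v := by
    intro v hv
    have h1 : 0 < δ * v := mul_pos hδ0 hv.1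
    have h2 : δ * v < Real.pi := lt_of_le_of_lt (mul_le_of_le_one_left hv.1.le hδ1) hv.2
    have h3 := (KK_deriv h1 h2).comp v ((hasDerivAt_id v).const_mul δ)
    have h4 := (KK_deriv hv.1 hv.2).sub (h3.const_mul δ)
    refine h4.congr_deriv ?_
    have := hv.1.ne'
    field_simp
    ring
  refine monotoneOn_of_deriv_nonneg (convex_Ico _ _) ?_ ?_ ?_
  · intro v hv
    have h1 : 0 ≤ δ * v := mul_nonneg hδ0.le hv.1
    have h2 : δ * v < Real.pi := lt_of_le_of_lt (mul_le_of_le_one_left hv.1 hδ1) hv.2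
    refine ContinuousAt.continuousWithinAt ?_
    refine (KK_cont (by rw [abs_of_nonneg hv.1]; exact hv.2)).sub (continuousAt_const.mul ?_)
    exact ContinuousAt.comp (f := fun v => δ * v) (KK_cont (by rwa [abs_of_nonneg h1]))
      (by fun_prop)
  · rw [interior_Ico]; intro v hv
    exact (hd v hv).differentiableAt.differentiableWithinAt
  · rw [interior_Ico]; intro v hv
    rw [(hd v hv).deriv]
    have h1 : 0 < δ * v := mul_pos hδ0 hv.1
    have h2 : δ * v < Real.pi := lt_of_le_of_lt (mul_le_of_le_one_left hv.1.le hδ1) hv.2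
    have hs := Real.sin_pos_of_pos_of_lt_pi hv.1 hv.2
    have hs2 := Real.sin_pos_of_pos_of_lt_pi h1 h2
    have hc := strictConcaveOn_sin_Icc.concaveOn.2
      (⟨le_refl _, Real.pi_pos.le⟩ : (0:ℝ) ∈ Set.Icc 0 Real.pi) ⟨hv.1.le, hv.2.le⟩
      (by linarith : (0:ℝ) ≤ 1 - δ) hδ0.le (by ring)
    simp only [smul_eq_mul, mul_zero, Real.sin_zero, zero_add] at hc
    have : (δ * Real.sin v) ^ 2 ≤ Real.sin (δ * v) ^ 2 := by gcongr
    rw [sub_nonneg, ← div_eq_mul_inv, div_le_iff₀ (by positivity), ← div_eq_inv_mul,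
      le_div_iff₀ (by positivity)]
    nlinarith

lemma L7 {K : ℝ → ℝ} {R x y : ℝ} (hodd : ∀ u, K (-u) = - K u) (h0 : K 0 = 0)
    (hm : MonotoneOn K (Set.Ico 0 R)) (hx : 0 < x) (hy : 0 ≤ y) (hR : x + y < R) :
    0 ≤ K (x - y) + K (x + y) := by
  have hxy : x + y ∈ Set.Ico 0 R := ⟨by linarith, hR⟩
  have h00 : (0:ℝ) ∈ Set.Ico 0 R := ⟨le_refl _, by linarith⟩
  rcases le_total y x with h | h
  · have h1 := hm h00 ⟨by linarith, by linarith⟩ (by linarith : (0:ℝ) ≤ x - y)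
    have h2 := hm h00 hxy (by linarith)
    rw [h0] at h1 h2; linarith
  · have h1 := hm (a := y - x) ⟨by linarith, by linarith⟩ hxy (by linarith)
    have := hodd (y - x)
    rw [neg_sub] at this
    linarith

lemma int_on {F g : ℝ → ℝ} (hF : memA F) (hg : ContinuousOn g (Set.Icc (-(1/2)) (1/2))) :
    Integrable (fun y => F y * g y) := by
  have : IntegrableOn (fun y => F y * g y) (Set.Icc (-(1/2)) (1/2)) :=
    (hF.1.continuousOn.mul hg).integrableOn_compact isCompact_Icc
  refine this.integrable_of_forall_notMem_eq_zero fun y hy => ?_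
  rw [hF.2.2.2.1 y hy, zero_mul]

lemma L8 {F g : ℝ → ℝ} (hF : memA F) (x : ℝ)
    (hg : ContinuousOn (fun y => g (x - y)) (Set.Icc (-(1/2)) (1/2)))
    (h : ∀ y, 0 ≤ y → y ≤ 1/2 → 0 ≤ g (x - y) + g (x + y)) :
    0 ≤ ∫ y, F y * g (x - y) := by
  have hi := int_on hF hg
  have e1 : ∫ y, F y * g (x - y) = ∫ y, F y * g (x + y) := by
    rw [← integral_neg_eq_self]
    simp only [hF.2.1, sub_neg_eq_add]
  have hi2 : Integrable (fun y => F y * g (x + y)) := by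
    have := hi.comp_neg
    simpa only [hF.2.1, sub_neg_eq_add] using this
  have e2 : 2 * ∫ y, F y * g (x - y) = ∫ y, (F y * g (x - y) + F y * g (x + y)) := by
    rw [integral_add hi hi2, ← e1]; ring
  have : 0 ≤ ∫ y, (F y * g (x - y) + F y * g (x + y)) := by
    refine integral_nonneg fun y => ?_
    simp only [Pi.zero_apply]
    rw [← mul_add]
    by_cases hy : y ∈ Set.Icc (-(1/2) : ℝ) (1/2)
    · refine mul_nonneg (hF.2.2.1 y) ?_
      rcases le_total 0 y with h0 | h0
      · exact h y h0 hy.2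
      · have := h (-y) (by linarith) (by linarith [hy.1])
        rw [sub_neg_eq_add, ← sub_eq_add_neg] at this
        linarith
    · rw [hF.2.2.2.1 y hy, zero_mul]
  linarith

lemma L6 {F : ℝ → ℝ} (hF : memA F) (Φ : ℂ → ℂ) (x : ℝ)
    (hΦ : ∀ ε ∈ Set.Icc (0:ℝ) 1, ∀ y ∈ Set.Icc (-(1/2) : ℝ) (1/2),
      ContinuousAt Φ ((x - y : ℝ) + ε * Complex.I)) :
    Filter.Tendsto (fun ε : ℝ => ∫ y, F y * (Φ ((x - y : ℝ) + ε * Complex.I)).re)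
      (nhdsWithin 0 (Set.Ioi 0)) (nhds (∫ y, F y * (Φ (x - y : ℝ)).re)) := by
  have hcomp : IsCompact (Set.Icc (0:ℝ) 1 ×ˢ Set.Icc (-(1/2) : ℝ) (1/2)) :=
    isCompact_Icc.prod isCompact_Icc
  have hca : ∀ p ∈ Set.Icc (0:ℝ) 1 ×ˢ Set.Icc (-(1/2) : ℝ) (1/2),
      ContinuousAt (fun p : ℝ × ℝ => (Φ ((x - p.2 : ℝ) + p.1 * Complex.I)).re) p := by
    intro p hp
    refine Complex.continuous_re.continuousAt.comp ?_
    exact ContinuousAt.comp (f := fun p : ℝ × ℝ => ((x - p.2 : ℝ) + p.1 * Complex.I : ℂ))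
      (hΦ p.1 hp.1 p.2 hp.2) (by fun_prop)
  obtain ⟨C, hC⟩ := hcomp.exists_bound_of_continuousOn
    (fun p hp => (hca p hp).continuousWithinAt)
  have hev : ∀ᶠ ε in nhdsWithin (0:ℝ) (Set.Ioi 0), ε ∈ Set.Icc (0:ℝ) 1 := by
    filter_upwards [Ioc_mem_nhdsGT (zero_lt_one' ℝ)] with ε hε
    exact ⟨hε.1.le, hε.2⟩
  refine tendsto_integral_filter_of_dominated_convergence (fun y => F y * C) ?_ ?_
    ((memA_int hF).mul_const C) ?_
  · filter_upwards [hev] with ε hε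
    refine (int_on hF fun y hy => ?_).1
    refine ContinuousAt.continuousWithinAt ?_
    exact ContinuousAt.comp (f := fun y : ℝ => ((ε, y) : ℝ × ℝ)) (hca (ε, y) ⟨hε, hy⟩)
      (by fun_prop)
  · filter_upwards [hev] with ε hε
    refine Filter.Eventually.of_forall fun y => ?_
    rw [norm_mul, Real.norm_of_nonneg (hF.2.2.1 y)]
    by_cases hy : y ∈ Set.Icc (-(1/2) : ℝ) (1/2)
    · exact mul_le_mul_of_nonneg_left (hC (ε, y) ⟨hε, hy⟩) (hF.2.2.1 y)
    · rw [hF.2.2.2.1 y hy, zero_mul, zero_mul]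
  · refine Filter.Eventually.of_forall fun y => ?_
    by_cases hy : y ∈ Set.Icc (-(1/2) : ℝ) (1/2)
    · refine Filter.Tendsto.const_mul _ ?_
      have h1 := hca (0, y) ⟨⟨le_refl _, zero_le_one⟩, hy⟩
      have h2 : ContinuousAt (fun ε : ℝ => (Φ ((x - y : ℝ) + ε * Complex.I)).re) 0 :=
        ContinuousAt.comp (f := fun ε : ℝ => ((ε, y) : ℝ × ℝ)) h1 (by fun_prop)
      have h3 := h2.tendsto
      simp only [Complex.ofReal_zero, zero_mul, add_zero] at h3
      exact h3.mono_left nhdsWithin_le_nhds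
    · simp [hF.2.2.2.1 y hy]

open FourierTransform SchwartzMap in
lemma exists_psi : ∃ ψ : ℝ → ℂ, Integrable ψ ∧ (∃ C : ℝ, ∀ x, ‖ψ x‖ * (1 + x ^ 2) ≤ C) ∧
    ∀ w ∈ Set.Icc (-(1/2) : ℝ) (1/2), 𝓕 ψ w = 1 := by
  let b : ContDiffBump (0 : ℝ) := ⟨1, 2, by norm_num, by norm_num⟩
  have hcs : HasCompactSupport (fun x => ((b x : ℝ) : ℂ)) :=
    b.hasCompactSupport.comp_left (g := fun r : ℝ => (r : ℂ)) (by simp)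
  have hcd : ContDiff ℝ (⊤ : ℕ∞) (fun x => ((b x : ℝ) : ℂ)) :=
    Complex.ofRealCLM.contDiff.comp b.contDiff
  let φ : 𝓢(ℝ, ℂ) := hcs.toSchwartzMap hcd
  let ψ : 𝓢(ℝ, ℂ) := 𝓕⁻ φ
  refine ⟨ψ, ψ.integrable, ?_, ?_⟩
  · obtain ⟨C0, -, h0⟩ := ψ.decay 0 0
    obtain ⟨C2, -, h2⟩ := ψ.decay 2 0
    refine ⟨C0 + C2, fun x => ?_⟩
    have h0 := h0 x
    have h2 := h2 x
    simp only [norm_iteratedFDeriv_zero, pow_zero, one_mul, Real.norm_eq_abs, sq_abs] at h0 h2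
    linarith
  · intro w hw
    have h1 : 𝓕 ψ = φ := fourier_fourierInv_eq φ
    rw [← SchwartzMap.fourier_coe, h1]
    change ((b w : ℝ) : ℂ) = 1
    rw [b.one_of_mem_closedBall]
    · simp
    · simp only [Metric.mem_closedBall, dist_zero_right, Real.norm_eq_abs]
      change |w| ≤ 1
      rw [abs_le]; constructor <;> linarith [hw.1, hw.2]

open FourierTransform in
lemma FT_eq (F : ℝ → ℝ) (t : ℝ) : FT F t = 𝓕 (fun x => (F x : ℂ)) t := by
  rw [Real.fourier_real_eq_integral_exp_smul, FT]
  congr 1; ext x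
  rw [smul_eq_mul, mul_comm]
  congr 2
  push_cast; ring

open FourierTransform in
lemma FT_conv {F : ℝ → ℝ} (hF : memA F) {ψ : ℝ → ℂ} (hψ : Integrable ψ)
    (h1 : ∀ w ∈ Set.Icc (-(1/2) : ℝ) (1/2), 𝓕 ψ w = 1) (k : ℝ) :
    FT F k = ∫ t, FT F t * ψ (t - k) := by
  have hFi : Integrable (fun x => (F x : ℂ)) := (memA_int hF).ofReal
  have hm := VectorFourier.integral_fourierIntegral_smul_eq_flip (L := innerₗ ℝ)
    (μ := volume) (ν := volume) (e := Real.fourierChar) Real.continuous_fourierChar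
    continuous_inner hFi (hψ.comp_sub_right k)
  have e1 : ∫ t, FT F t * ψ (t - k) = ∫ x, (F x : ℂ) * 𝓕 (fun t => ψ (t - k)) x := by
    simp only [FT_eq]
    simpa using! hm
  rw [e1, FT]
  congr 1; ext x
  by_cases hx : x ∈ Set.Icc (-(1/2) : ℝ) (1/2)
  · congr 1
    rw [Real.fourier_real_eq_integral_exp_smul]
    have e2 := integral_add_right_eq_self (μ := volume)
      (fun v : ℝ => Complex.exp (↑(-2 * Real.pi * v * x) * Complex.I) • ψ (v - k)) k
    rw [← e2]
    have e3 := h1 x hx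
    rw [Real.fourier_real_eq_integral_exp_smul] at e3
    have e4 : ∀ v : ℝ, Complex.exp (↑(-2 * Real.pi * (v + k) * x) * Complex.I) • ψ (v + k - k)
      = Complex.exp (-(2 * Real.pi * Complex.I) * k * x) *
        (Complex.exp (↑(-2 * Real.pi * v * x) * Complex.I) • ψ v) := by
      intro v
      rw [add_sub_cancel_right, smul_eq_mul, smul_eq_mul, ← mul_assoc, ← Complex.exp_add]
      congr 2
      push_cast; ring
    simp only [e4]
    rw [integral_const_mul, e3, mul_one]
  · rw [hF.2.2.2.1 x hx]; simp

lemma unif_sum {ψ : ℝ → ℂ} {C : ℝ} (hC : ∀ x, ‖ψ x‖ * (1 + x ^ 2) ≤ C) :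
    ∃ M : ℝ, ∀ (s : Finset ℤ) (t : ℝ), ∑ k ∈ s, ‖ψ (t - k)‖ ≤ M := by
  have hC0 : 0 ≤ C := le_trans (by positivity) (hC 0)
  let b : ℤ → ℝ := fun j => 2 * C * (1 / (1 + (j:ℝ) ^ 2))
  have hb : Summable b := by
    refine Summable.mul_left _ ?_
    have h := (Real.summable_one_div_int_pow (p := 2)).2 (by norm_num)
    refine Summable.of_norm_bounded_eventually h ?_
    have : ∀ᶠ j : ℤ in Filter.cofinite, j ≠ 0 := by
      simpa using (Set.finite_singleton (0:ℤ)).compl_mem_cofinite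
    filter_upwards [this] with j hj
    have hj' : (j:ℝ) ≠ 0 := by exact_mod_cast hj
    rw [Real.norm_of_nonneg (by positivity)]
    have : 0 < (j:ℝ)^2 := by positivity
    gcongr
    linarith
  have hb0 : ∀ j, 0 ≤ b j := fun j => by positivity
  refine ⟨∑' j, b j, fun s t => ?_⟩
  have h1 : ∀ k ∈ s, ‖ψ (t - k)‖ ≤ b (k - round t) := by
    intro k _
    have ha := abs_le.1 (abs_sub_round t)
    have hc := hC (t - k)
    simp only [b]
    push_cast
    set r : ℝ := (round t : ℝ)
    rw [mul_one_div, le_div_iff₀ (by positivity)]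
    have : 1 + ((k:ℝ) - r) ^ 2 ≤ 2 * (1 + (t - k) ^ 2) := by
      nlinarith [sq_nonneg (2 * (t - k) - (t - r)), sq_nonneg (2*t - k - r), mul_nonneg (sub_nonneg.2 ha.1) (sub_nonneg.2 ha.2)]
    nlinarith [norm_nonneg (ψ (t - k))]
  have hb2 : Summable (fun k : ℤ => b (k - round t)) := (Equiv.subRight (round t)).summable_iff.2 hb
  calc ∑ k ∈ s, ‖ψ (t - k)‖ ≤ ∑ k ∈ s, b (k - round t) := Finset.sum_le_sum h1
    _ ≤ ∑' k, b (k - round t) := hb2.sum_le_tsum s (fun k _ => hb0 _)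
    _ = ∑' j, b j := (Equiv.subRight (round t)).tsum_eq b

lemma FT_summable {F : ℝ → ℝ} (hF : memA F) : Summable (fun k : ℤ => ‖FT F k‖) := by
  obtain ⟨ψ, hψ, ⟨C, hC⟩, h1⟩ := exists_psi
  obtain ⟨M, hM⟩ := unif_sum hC
  have hFT := hF.2.2.2.2
  have hb : ∀ x, ‖ψ x‖ ≤ C := fun x => by
    nlinarith [hC x, norm_nonneg (ψ x), mul_nonneg (norm_nonneg (ψ x)) (sq_nonneg x)]
  have hint : ∀ k : ℤ, Integrable (fun t => ‖FT F t‖ * ‖ψ (t - k)‖) := by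
    intro k
    exact hFT.norm.mul_bdd (c := C) (hψ.comp_sub_right (k:ℝ)).1.norm
      (Filter.Eventually.of_forall fun t => by simpa using hb (t - k))
  refine summable_of_sum_le (c := ∫ t, ‖FT F t‖ * M) (fun k => norm_nonneg _) fun s => ?_
  calc ∑ k ∈ s, ‖FT F k‖ ≤ ∑ k ∈ s, ∫ t, ‖FT F t‖ * ‖ψ (t - k)‖ := by
        refine Finset.sum_le_sum fun k _ => ?_
        rw [FT_conv hF hψ h1 k]
        refine (norm_integral_le_integral_norm _).trans (le_of_eq ?_)
        simp only [norm_mul]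
    _ = ∫ t, ∑ k ∈ s, ‖FT F t‖ * ‖ψ (t - k)‖ := (integral_finsetSum _ fun k _ => hint k).symm
    _ ≤ ∫ t, ‖FT F t‖ * M := by
        refine integral_mono (integrable_finsetSum _ fun k _ => hint k) (hFT.norm.mul_const _) ?_
        intro t
        simp only
        rw [← Finset.mul_sum]
        exact mul_le_mul_of_nonneg_left (hM s t) (norm_nonneg _)

lemma tm_norm (F : ℝ → ℝ) (δ θ : ℝ) (k : ℤ) :
    ‖tm F δ θ k‖ = ‖(Int.sign k : ℂ)‖ * ‖FT F (δ * k)‖ := by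
  have : ‖Complex.exp (2 * Real.pi * Complex.I * k * θ)‖ = 1 := by
    rw [Complex.norm_exp]; simp
  rw [tm, norm_mul, this, norm_mul, norm_mul]
  simp

lemma tm_summable_one {F : ℝ → ℝ} (hF : memA F) (θ : ℝ) : Summable (tm F 1 θ) := by
  refine Summable.of_norm_bounded (FT_summable hF) fun k => ?_
  rw [tm_norm, one_mul]
  refine mul_le_of_le_one_left (norm_nonneg _) ?_
  rcases Int.sign_trichotomy k with h | h | h <;> simp [h]

lemma tm_summable_of {F : ℝ → ℝ} {δ θ : ℝ} (hs : Summable (tm F δ θ)) (θ' : ℝ) :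
    Summable (tm F δ θ') := by
  refine Summable.of_norm ?_
  have := hs.norm
  simpa only [tm_norm] using this

lemma HilbPer_cont {F : ℝ → ℝ} {δ θ : ℝ} (hs : Summable (tm F δ θ)) :
    Continuous (HilbPer F δ) := by
  have h := hs.norm
  refine continuous_tsum (u := fun k => ‖tm F δ θ k‖) (fun k => by fun_prop) h fun k θ' => ?_
  change ‖tm F δ θ' k‖ ≤ _
  rw [tm_norm, tm_norm]

lemma propA {F : ℝ → ℝ} (hF : memA F) {δ x : ℝ} (hδ : 0 < δ) (hx : δ * (|x| + 1/2) < 1)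
    (hs : Summable (tm F δ (δ * x))) :
    (HilbR F x).re - δ * (HilbPer F δ (δ * x)).re
      = ∫ y, F y * (δ * KK (Real.pi * δ * (x - y))) := by
  have hp := Real.pi_pos
  have hbd : ∀ y ∈ Set.Icc (-(1/2) : ℝ) (1/2), |Real.pi * δ * (x - y)| < Real.pi := by
    intro y hy
    have h1 : |x - y| ≤ |x| + 1/2 := (abs_sub x y).trans (by
      have : |y| ≤ 1/2 := abs_le.2 ⟨hy.1, hy.2⟩
      linarith)
    rw [abs_mul, abs_of_pos (by positivity : 0 < Real.pi * δ)]
    have : δ * |x - y| < 1 := lt_of_le_of_lt (by gcongr) hx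
    nlinarith
  let Φ : ℂ → ℂ := fun z => δ * ((Real.pi * δ * z)⁻¹ - Complex.cot (Real.pi * δ * z))
  have h6 := L6 hF Φ x ?_
  · have h5 := (L5R hF x).sub ((L5per hF hδ x hs).const_mul δ)
    have e2 : ∀ y, (Φ ((x - y : ℝ))).re = δ * KK (Real.pi * δ * (x - y)) := by
      intro y
      simp only [Φ]
      rw [Complex.re_ofReal_mul]
      congr 1
      rw [← KK_re]
      push_cast
      rfl
    simp only [e2] at h6
    refine tendsto_nhds_unique h5 (h6.congr' ?_)
    filter_upwards [self_mem_nhdsWithin] with ε hε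
    have hε : 0 < ε := hε
    have hz : ∀ y : ℝ, ((x - y : ℝ) + ε * Complex.I : ℂ) ≠ 0 := by
      intro y h0; have := congrArg Complex.im h0; simp at this; exact hε.ne' this
    have hpC : (Real.pi : ℂ) ≠ 0 := by exact_mod_cast hp.ne'
    have hdC : (δ : ℂ) ≠ 0 := by exact_mod_cast hδ.ne'
    rw [← integral_const_mul, ← integral_sub]
    · congr 1; ext y
      have : (Φ ((x - y : ℝ) + ε * Complex.I)) =
        (Real.pi * ((x - y : ℝ) + ε * Complex.I) : ℂ)⁻¹ - δ * Complex.cot (Real.pi * δ * ((x - y : ℝ) + ε * Complex.I)) := by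
        have := hz y
        simp only [Φ]
        rw [mul_sub]
        congr 1
        field_simp
      rw [this, Complex.sub_re, Complex.re_ofReal_mul]
      ring
    · refine int_on hF (Continuous.continuousOn ?_)
      refine Complex.continuous_re.comp ?_
      exact Continuous.inv₀ (by fun_prop) fun y => mul_ne_zero hpC (hz y)
    · refine Integrable.const_mul (int_on hF (ContinuousOn.comp (t := Set.univ) Complex.continuous_re.continuousOn ?_ (fun _ _ => trivial))) δ
      have : Complex.cot = fun w => Complex.cos w / Complex.sin w := by ext w; rfl
      rw [this]
      refine ContinuousOn.div (by fun_prop) (by fun_prop) fun y hy => ?_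
      refine sin_ne_zero_of_re (mul_ne_zero (mul_ne_zero hpC hdC) (hz y)) ?_
      have := hbd y hy
      rw [← Complex.ofReal_mul, Complex.re_ofReal_mul]
      simpa using this
  · intro ε hε y hy
    refine continuousAt_const.mul ?_
    refine ContinuousAt.comp (f := fun z : ℂ => (Real.pi * δ * z : ℂ))
      (g := fun w : ℂ => w⁻¹ - Complex.cot w) (G_cont ?_) (by fun_prop)
    have := hbd y hy
    rw [← Complex.ofReal_mul, Complex.re_ofReal_mul]
    simpa using this

lemma propC {F : ℝ → ℝ} (hF : memA F) {δ x : ℝ} (hδ : 0 < δ) (hδ1 : δ ≤ 1) (hx : x < -(1/2))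
    (hx2 : -(1/2) < δ * x) (hs : Summable (tm F δ (δ * x))) :
    (HilbPer F δ (δ * x)).re ≤ 0 := by
  have hp := Real.pi_pos
  have hbd : ∀ y ∈ Set.Icc (-(1/2) : ℝ) (1/2), -Real.pi < Real.pi * δ * (x - y) ∧
      Real.pi * δ * (x - y) < 0 := by
    intro y hy
    have h1 : x - y < 0 := by linarith [hy.1]
    have h2 : -1 < δ * (x - y) := by nlinarith [hy.2]
    constructor
    · nlinarith
    · exact mul_neg_of_pos_of_neg (by positivity) h1
  have hcc : ∀ w : ℂ, w ≠ 0 → |w.re| < Real.pi → ContinuousAt Complex.cot w := by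
    intro w h0 h1
    have : Complex.cot = fun w => Complex.cos w / Complex.sin w := by ext w; rfl
    rw [this]
    exact Complex.continuous_cos.continuousAt.div Complex.continuous_sin.continuousAt
      (sin_ne_zero_of_re h0 h1)
  have h6 := L6 hF (fun z : ℂ => Complex.cot (Real.pi * δ * z)) x ?_
  · have e := tendsto_nhds_unique (L5per hF hδ x hs) h6
    have e2 : ∀ y : ℝ, (Complex.cot (Real.pi * δ * (x - y : ℝ))).re
        = - (- Real.cot (Real.pi * δ * (x - y))) := by
      intro y
      rw [neg_neg, ← Complex.ofReal_mul, ← Complex.ofReal_mul, ← Complex.ofReal_cot,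
        Complex.ofReal_re]
    simp only [e2, mul_neg, integral_neg] at e
    have h8 := L8 (g := fun u => - Real.cot (Real.pi * δ * u)) hF x ?_ ?_
    · simp only [mul_neg, integral_neg] at h8
      linarith
    · refine ContinuousOn.neg fun y hy => ContinuousAt.continuousWithinAt ?_
      have : Real.cot = fun w => Real.cos w / Real.sin w := by
        ext w; exact Real.cot_eq_cos_div_sin w
      rw [this]
      have hb := hbd y hy
      refine ContinuousAt.div (by fun_prop) (by fun_prop) ?_
      exact (Real.sin_neg_of_neg_of_neg_pi_lt hb.2 hb.1).ne
    · intro y h0 h1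
      have b1 := hbd y ⟨by linarith, h1⟩
      have b2 := hbd (-y) ⟨by linarith, by linarith⟩
      rw [sub_neg_eq_add] at b2
      have s1 := Real.sin_neg_of_neg_of_neg_pi_lt b1.2 b1.1
      have s2 := Real.sin_neg_of_neg_of_neg_pi_lt b2.2 b2.1
      have s3 : Real.sin (Real.pi * δ * (x - y) + Real.pi * δ * (x + y)) < 0 :=
        Real.sin_neg_of_neg_of_neg_pi_lt (by linarith) (by nlinarith)
      rw [Real.sin_add] at s3
      set A := Real.pi * δ * (x - y)
      set B := Real.pi * δ * (x + y)
      have : -Real.cot A + -Real.cot B =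
        -((Real.sin A * Real.cos B + Real.cos A * Real.sin B) / (Real.sin A * Real.sin B)) := by
        rw [Real.cot_eq_cos_div_sin, Real.cot_eq_cos_div_sin]
        have := s1.ne
        have := s2.ne
        field_simp
        ring
      rw [this, neg_nonneg]
      exact div_nonpos_of_nonpos_of_nonneg s3.le (mul_pos_of_neg_of_neg s1 s2).le
  · intro ε hε y hy
    refine ContinuousAt.comp (f := fun z : ℂ => (Real.pi * δ * z : ℂ)) (hcc _ ?_ ?_) (by fun_prop)
    · intro h0
      have := congrArg Complex.re h0
      rw [← Complex.ofReal_mul, Complex.re_ofReal_mul] at this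
      simp at this
      have hb := (hbd y hy).2
      rcases this with h | h
      · exact hδ.ne' h
      · rw [h] at hb; simp at hb
    · have hb := hbd y hy
      rw [← Complex.ofReal_mul, Complex.re_ofReal_mul]
      have : |Real.pi * δ * (x - y)| < Real.pi := abs_lt.2 ⟨hb.1, by linarith⟩
      simpa using this

lemma summable_of_re_pos {F : ℝ → ℝ} {δ θ : ℝ} (h : 0 < (HilbPer F δ θ).re) :
    Summable (tm F δ θ) := by
  by_contra hc
  have : HilbPer F δ θ = 0 := tsum_eq_zero_of_not_summable hc
  rw [this] at h
  simp at h

lemma KKc_contOn {δ x : ℝ} (hδ : 0 < δ) (hx : δ * (|x| + 1/2) < 1) :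
    ContinuousOn (fun y => KK (Real.pi * δ * (x - y))) (Set.Icc (-(1/2) : ℝ) (1/2)) := by
  have hp := Real.pi_pos
  intro y hy
  have h1 : |x - y| ≤ |x| + 1/2 := (abs_sub x y).trans (by
    have : |y| ≤ 1/2 := abs_le.2 ⟨hy.1, hy.2⟩
    linarith)
  refine ContinuousAt.continuousWithinAt ?_
  refine ContinuousAt.comp (f := fun y => Real.pi * δ * (x - y)) (KK_cont ?_) (by fun_prop)
  rw [abs_mul, abs_of_pos (by positivity : 0 < Real.pi * δ)]
  have : δ * |x - y| < 1 := lt_of_le_of_lt (by gcongr) hx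
  nlinarith

lemma caseOne {F : ℝ → ℝ} (hF : memA F) {δ x : ℝ} (hδ : 0 < δ) (hδ1 : δ ≤ 1) (hx0 : 0 < x)
    (hx : δ * x < 1/2) (hs : Summable (tm F δ (δ * x))) :
    δ * (HilbPer F δ (δ * x)).re ≤ (HilbR F x).re := by
  have hp := Real.pi_pos
  have hx' : δ * (|x| + 1/2) < 1 := by rw [abs_of_pos hx0]; nlinarith
  have hA := propA hF hδ hx' hs
  have h8 := L8 (g := fun u => δ * KK (Real.pi * δ * u)) hF x
    (continuousOn_const.mul (KKc_contOn hδ hx')) ?_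
  · linarith
  · intro y h0 h1
    have h7 := L7 (K := KK) (R := Real.pi) (x := Real.pi * δ * x) (y := Real.pi * δ * y)
      KK_odd KK_zero KK_mono (by positivity) (by positivity) (by nlinarith [mul_le_mul_of_nonneg_left h1 hδ.le])
    rw [← mul_sub, ← mul_add] at h7
    rw [← mul_add]
    exact mul_nonneg hδ.le h7

lemma caseTwo {F : ℝ → ℝ} (hF : memA F) {δ x : ℝ} (hδ : 0 < δ) (hδ1 : δ ≤ 1) (hx0 : x < 0)
    (hx : -(1/2) < x) (hs : Summable (tm F δ (δ * x))) :
    δ * (HilbPer F δ (δ * x)).re ≤ (HilbPer F 1 x).re := by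
  have hp := Real.pi_pos
  have hx1 : (1:ℝ) * (|x| + 1/2) < 1 := by rw [abs_of_neg hx0]; linarith
  have hx' : δ * (|x| + 1/2) < 1 := by
    refine lt_of_le_of_lt ?_ hx1
    gcongr
  have hA := propA hF hδ hx' hs
  have hB := propA hF one_pos hx1 (tm_summable_one hF _)
  rw [one_mul, one_mul] at hB
  simp only [mul_one, one_mul] at hB
  have c1 : ContinuousOn (fun y => δ * KK (Real.pi * δ * (x - y))) (Set.Icc (-(1/2) : ℝ) (1/2)) :=
    continuousOn_const.mul (KKc_contOn hδ hx')
  have c2 := KKc_contOn one_pos hx1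
  simp only [mul_one] at c2
  have h8 := L8 (g := fun u => δ * KK (Real.pi * δ * u) - KK (Real.pi * u)) hF x
    (c1.sub c2) ?_
  · simp only [mul_sub] at h8
    have i1 := int_on hF c1
    have i2 := int_on hF c2
    have e := integral_sub i1 i2
    simp only [mul_sub] at e hA hB
    rw [e] at h8
    linarith
  · intro y h0 h1
    have h7 := L7 (K := fun v => KK v - δ * KK (δ * v)) (R := Real.pi) (x := Real.pi * (-x))
      (y := Real.pi * y)
      (fun u => by simp only [mul_neg, KK_odd]; ring) (by simp [KK_zero]) (EE_mono hδ hδ1)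
      (mul_pos hp (by linarith)) (by positivity) (by nlinarith)
    have e1 : Real.pi * -x - Real.pi * y = -(Real.pi * (x + y)) := by ring
    have e2 : Real.pi * -x + Real.pi * y = -(Real.pi * (x - y)) := by ring
    have e3 : δ * (Real.pi * (x + y)) = Real.pi * δ * (x + y) := by ring
    have e4 : δ * (Real.pi * (x - y)) = Real.pi * δ * (x - y) := by ring
    simp only [e1, e2] at h7
    simp only [mul_neg, KK_odd, e3, e4] at h7
    linarith

theorem stmt9 (F : ℝ → ℝ) (hF : memA F) (δ : ℝ) (hδ0 : 0 < δ) (hδ1 : δ ≤ 1) :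
    (∀ θ : ℝ, 0 < θ → θ < 1/2 → 0 < (HilbPer F δ θ).re →
      δ * (HilbPer F δ θ).re ≤ (HilbR F (θ / δ)).re) ∧
    (∀ θ : ℝ, -(1/2) < θ → θ < 0 → 0 < (HilbPer F δ θ).re →
      -(δ/2) < θ ∧ δ * (HilbPer F δ θ).re ≤ (HilbPer F 1 (θ / δ)).re) := by
  refine ⟨fun θ h0 h1 hpos => ?_, fun θ h1 h0 hpos => ?_⟩
  · have hs := summable_of_re_pos hpos
    have e : δ * (θ / δ) = θ := by field_simp
    have := caseOne hF (x := θ / δ) hδ0 hδ1 (by positivity) (by rwa [e]) (by rwa [e])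
    rwa [e] at this
  · have hs := summable_of_re_pos hpos
    have e : ∀ θ : ℝ, δ * (θ / δ) = θ := fun θ => by field_simp
    have hθ : -(δ/2) < θ := by
      by_contra hc
      push Not at hc
      have hcont : ContinuousAt (fun t => (HilbPer F δ t).re) θ :=
        (Complex.continuous_re.comp (HilbPer_cont hs)).continuousAt
      have hev : ∀ᶠ t in nhdsWithin θ (Set.Iio θ), (HilbPer F δ t).re ≤ 0 := by
        filter_upwards [Ioo_mem_nhdsLT h1] with t ht
        have := propC hF (x := t / δ) hδ0 hδ1 (by
          rw [div_lt_iff₀ hδ0]; linarith [ht.2]) (by rw [e]; exact ht.1)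
          (tm_summable_of hs _)
        rwa [e] at this
      have := le_of_tendsto (hcont.tendsto.mono_left nhdsWithin_le_nhds) hev
      linarith
    refine ⟨hθ, ?_⟩
    have := caseTwo hF (x := θ / δ) hδ0 hδ1 (div_neg_of_neg_of_pos h0 hδ0) (by
      rw [lt_div_iff₀ hδ0]; linarith) (by rwa [e])
    rwa [e] at this
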